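/- arXiv:1304.4140 — 4 statements merged into one kernel-verified Lean document; each statement's English description precedes it below -/
import Mathlib

section
/- Let H and K be complex Hilbert spaces and let Φ : B(H) → B(K) be an injective star-algebra homomorphism between the algebras of bounded operators. If x ∈ B(H) is such that Φ(x) is a compact operator on K, then x is a compact operator on H. -/
open Filter Topology in
/-- A non-compact operator is bounded below along some orthonormal sequence. -/
theorem exists_orthonormal_of_not_compact {H : Type*}
    [NormedAddCommGroup H] [InnerProductSpace ℂ H] [CompleteSpace H]
    (x : H →L[ℂ] H) (hx : ¬ IsCompactOperator x) :
    ∃ ε > 0, ∃ e : ℕ → H, Orthonormal ℂ e ∧ ∀ n, ε ≤ ‖x (e n)‖ := by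
  by_contra hcon
  apply hx
  have hcl := isClosed_setOfPred_isCompactOperator (σ₁₂ := RingHom.id ℂ) (M₁ := H) (M₂ := H)
  suffices x ∈ closure { f : H →L[ℂ] H | IsCompactOperator f } by
    rw [hcl.closure_eq] at this
    exact this
  rw [Metric.mem_closure_iff]
  intro ε hε
  by_contra hfar
  apply hcon
  refine ⟨ε / 2, by positivity, ?_⟩
  have key : ∀ s : Finset H, (∀ y ∈ s, ‖y‖ = 1 ∧ ε / 2 ≤ ‖x y‖) →
      ∃ y, (‖y‖ = 1 ∧ ε / 2 ≤ ‖x y‖) ∧ ∀ z ∈ s, inner ℂ z y = 0 := by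
    intro s _
    by_contra hno
    apply hfar
    let V : Submodule ℂ H := Submodule.span ℂ (s : Set H)
    have : FiniteDimensional ℂ V := FiniteDimensional.span_finset ℂ s
    refine ⟨x ∘L V.starProjection, ?_, ?_⟩
    · have : ProperSpace V := FiniteDimensional.proper ℂ V
      have h1 : IsCompactOperator (V.orthogonalProjectionOnto) :=
        isCompactOperator_of_locallyCompactSpace_dom _
      exact h1.clm_comp (x ∘L V.subtypeL)
    · rw [dist_eq_norm]
      refine lt_of_le_of_lt (ContinuousLinearMap.opNorm_le_bound _ (by positivity : 0 ≤ ε / 2) ?_)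
        (half_lt_self hε)
      intro v
      set w := v - V.starProjection v with hw
      have hwV : w ∈ Vᗮ := V.sub_starProjection_mem_orthogonal v
      have hxw : (x - x ∘L V.starProjection) v = x w := by simp [hw]
      have hwv : ‖w‖ ≤ ‖v‖ := by
        have h2 : w = Vᗮ.starProjection v := by
          rw [Submodule.starProjection_orthogonal_val]
        rw [h2]
        exact Submodule.norm_starProjection_apply_le _ _
      rw [hxw]
      refine le_trans ?_ (mul_le_mul_of_nonneg_left hwv (by positivity))
      by_cases hw0 : w = 0
      · simp [hw0]
      by_contra hlt
      push Not at hlt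
      apply hno
      have hpos : 0 < ‖w‖ := norm_pos_iff.mpr hw0
      refine ⟨((‖w‖⁻¹ : ℝ) : ℂ) • w, ⟨?_, ?_⟩, ?_⟩
      · rw [norm_smul]; simp [hpos.ne']
      · rw [map_smul, norm_smul]
        simp only [Complex.norm_real, norm_inv, norm_norm]
        rw [inv_mul_eq_div, le_div_iff₀ hpos]
        exact hlt.le
      · intro z hz
        rw [inner_smul_right, hwV z (Submodule.subset_span hz), mul_zero]
  obtain ⟨e, he1, he2⟩ := exists_seq_of_forall_finset_exists _ _ key
  refine ⟨e, ⟨fun n => (he1 n).1, ?_⟩, fun n => (he1 n).2⟩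
  intro m n hmn
  rcases lt_or_gt_of_ne hmn with h | h
  · exact he2 m n h
  · exact inner_eq_zero_symm.mp (he2 n m h)

open Filter Topology in
/-- A compact operator is not bounded below along an orthonormal sequence. -/
theorem not_compact_of_orthonormal {K : Type*}
    [NormedAddCommGroup K] [InnerProductSpace ℂ K] [CompleteSpace K]
    (T : K →L[ℂ] K) (hT : IsCompactOperator T) (f : ℕ → K) (hf : Orthonormal ℂ f)
    (ε : ℝ) (hε : 0 < ε) (hb : ∀ n, ε ≤ ‖T (f n)‖) : False := by
  obtain ⟨S, hS, hsub⟩ := IsCompactOperator.image_closedBall_subset_compact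
    (f := (T : K →ₗ[ℂ] K)) hT 1
  have hmem : ∀ n, T (f n) ∈ S := fun n => hsub ⟨f n, by simp [hf.1 n], rfl⟩
  obtain ⟨y, _, φ, hφ, hlim⟩ := hS.tendsto_subseq hmem
  have h0 : Tendsto (fun n => ‖inner ℂ (f n) (T.adjoint y)‖ ^ 2) atTop (𝓝 0) :=
    (hf.inner_products_summable (T.adjoint y)).tendsto_atTop_zero
  have h1 := h0.comp hφ.tendsto_atTop
  have h2 : Tendsto (fun n => ‖inner ℂ (T (f (φ n))) y‖ ^ 2) atTop (𝓝 (‖inner ℂ y y‖ ^ 2)) :=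
    ((hlim.inner tendsto_const_nhds).norm.pow 2)
  have h3 : ‖inner ℂ y y‖ ^ 2 = 0 := by
    refine tendsto_nhds_unique h2 (h1.congr fun n => ?_)
    simp [ContinuousLinearMap.adjoint_inner_right]
  have hy : y = 0 := by simpa using h3
  have h4 : ε ≤ ‖y‖ := ge_of_tendsto' hlim.norm fun n => hb _
  rw [hy, norm_zero] at h4
  linarith


/-- If `Φ : B(H) → B(K)` is an injective star-algebra homomorphism between the algebras of
bounded operators on complex Hilbert spaces, and `Φ x` is a compact operator on `K`,
then `x` is a compact operator on `H`. -/
theorem stmt_0 {H K : Type*}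
    [NormedAddCommGroup H] [InnerProductSpace ℂ H] [CompleteSpace H]
    [NormedAddCommGroup K] [InnerProductSpace ℂ K] [CompleteSpace K]
    (Φ : (H →L[ℂ] H) →⋆ₙₐ[ℂ] (K →L[ℂ] K)) (hΦ : Function.Injective Φ)
    (x : H →L[ℂ] H) (hx : IsCompactOperator (Φ x : K →L[ℂ] K)) :
    IsCompactOperator (x : H →L[ℂ] H) := by
  by_contra hnc
  obtain ⟨ε, hε, e, he, hb⟩ := exists_orthonormal_of_not_compact x hnc
  let p : ℕ → (H →L[ℂ] H) := fun n => InnerProductSpace.rankOne ℂ (e n) (e n)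
  have hps : ∀ n, star (p n) = p n := fun n => by
    rw [ContinuousLinearMap.star_eq_adjoint]; exact InnerProductSpace.adjoint_rankOne _ _
  have hpp : ∀ n, p n * p n = p n := fun n =>
    InnerProductSpace.isIdempotentElem_rankOne_self (he.1 n)
  have hpo : ∀ m n, m ≠ n → p m * p n = 0 := fun m n hmn => by
    ext v
    simp [p, he.2 hmn]
  have hpx : ∀ n, p n * (star x * x) * p n = ((‖x (e n)‖ ^ 2 : ℝ) : ℂ) • p n := fun n => by
    ext v
    simp only [p, ContinuousLinearMap.mul_apply, InnerProductSpace.rankOne_apply, map_smul,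
      ContinuousLinearMap.star_eq_adjoint, ContinuousLinearMap.smul_apply, inner_smul_right,
      ContinuousLinearMap.adjoint_inner_right, inner_self_eq_norm_sq_to_K, smul_smul]
    congr 1
    push_cast
    exact mul_comm _ _
  have hf : ∀ n, ∃ f : K, ‖f‖ = 1 ∧ Φ (p n) f = f := fun n => by
    have hne : Φ (p n) ≠ 0 := by
      intro h
      have h0 : p n = 0 := hΦ (by rw [h, map_zero])
      have hen : e n ≠ 0 := he.ne_zero n
      exact InnerProductSpace.rankOne_ne_zero hen hen h0
    obtain ⟨v, hv⟩ : ∃ v, Φ (p n) v ≠ 0 := by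
      by_contra h
      push Not at h
      exact hne (ContinuousLinearMap.ext h)
    have hfix : Φ (p n) (Φ (p n) v) = Φ (p n) v := by
      rw [← ContinuousLinearMap.mul_apply, ← map_mul, hpp]
    refine ⟨((‖Φ (p n) v‖⁻¹ : ℝ) : ℂ) • Φ (p n) v, ?_, ?_⟩
    · rw [norm_smul]; simp [hv]
    · rw [map_smul, hfix]
  choose f hf1 hf2 using hf
  have hadj : ∀ n (u v : K), inner ℂ (Φ (p n) u) v = inner ℂ u (Φ (p n) v) := fun n u v => by
    conv_rhs => rw [← hps n, map_star, ContinuousLinearMap.star_eq_adjoint,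
      ContinuousLinearMap.adjoint_inner_right]
  have hfo : Orthonormal ℂ f := by
    refine ⟨hf1, fun m n hmn => ?_⟩
    change inner ℂ (f m) (f n) = 0
    rw [← hf2 m, ← hf2 n, hadj, ← ContinuousLinearMap.mul_apply, ← map_mul, hpo m n hmn]
    simp
  refine not_compact_of_orthonormal (Φ x) hx f hfo ε hε fun n => ?_
  have hnorm : ‖Φ x (f n)‖ ^ 2 = ‖x (e n)‖ ^ 2 := by
    have h1 : inner ℂ (f n) (Φ (p n * (star x * x) * p n) (f n))
        = inner ℂ (Φ x (f n)) (Φ x (f n)) := by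
      rw [map_mul, map_mul, map_mul, map_star, ContinuousLinearMap.mul_apply, hf2,
        ContinuousLinearMap.mul_apply, ← hadj, hf2, ContinuousLinearMap.mul_apply,
        ContinuousLinearMap.star_eq_adjoint, ContinuousLinearMap.adjoint_inner_right]
    rw [hpx, map_smul, ContinuousLinearMap.smul_apply, hf2, inner_smul_right,
      inner_self_eq_norm_sq_to_K, inner_self_eq_norm_sq_to_K, hf1] at h1
    simp only [Complex.coe_algebraMap, Complex.ofReal_one, one_pow, mul_one] at h1
    exact_mod_cast h1.symm
  have hEq : ‖Φ x (f n)‖ = ‖x (e n)‖ :=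
    (sq_eq_sq₀ (norm_nonneg _) (norm_nonneg _)).mp hnorm
  rw [hEq]
  exact hb n
end

section
/- Let H be a complex Hilbert space and let M be a von Neumann algebra acting on H. If M contains a nonzero compact operator, then M contains a nonzero minimal projection, i.e. there exists a projection p ∈ M with p ≠ 0 such that every projection q ∈ M satisfying q = p·q = q·p is equal to 0 or to p. -/
/-- If a von Neumann algebra `M` on a complex Hilbert space contains a nonzero compact
operator, then it contains a nonzero minimal projection. -/
theorem stmt_2 {H : Type*} [NormedAddCommGroup H] [InnerProductSpace ℂ H] [CompleteSpace H]
    (M : VonNeumannAlgebra H)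
    (a : H →L[ℂ] H) (haM : a ∈ M) (ha0 : a ≠ 0) (hac : IsCompactOperator a) :
    ∃ p : H →L[ℂ] H, p ∈ M ∧ p ≠ 0 ∧ star p = p ∧ p * p = p ∧
      ∀ q : H →L[ℂ] H, q ∈ M → star q = q → q * q = q →
        q = p * q → q = q * p → q = 0 ∨ q = p := by
  classical
  obtain ⟨T, hTM, hT0, hTc, hTs⟩ : ∃ T : H →L[ℂ] H, T ∈ M ∧ T ≠ 0 ∧ IsCompactOperator T ∧
      (T : H →ₗ[ℂ] H).IsSymmetric := by
    refine ⟨star a * a, mul_mem (star_mem haM) haM, ?_, hac.clm_comp (star a), ?_⟩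
    · intro h
      exact ha0 ((CStarRing.star_mul_self_eq_zero_iff a).1 h)
    · exact (IsSelfAdjoint.star_mul_self a).isSymmetric
  obtain ⟨μ, hμ0, hμ⟩ : ∃ μ : ℂ, μ ≠ 0 ∧ Module.End.HasEigenvalue (T : H →ₗ[ℂ] H) μ := by
    by_contra! hcon
    refine hT0 ((ContinuousLinearMap.eq_zero_of_forall_hasEigenvalue_eq_zero hTc hTs).1 ?_)
    intro μ hμ
    by_contra h
    exact hcon μ h hμ
  have hfin : FiniteDimensional ℂ (Module.End.eigenspace (T : H →ₗ[ℂ] H) μ) :=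
    ContinuousLinearMap.finite_dimensional_eigenspace hTc μ hμ0
  set E := Module.End.eigenspace (T : H →ₗ[ℂ] H) μ with hE
  let S : Set (H →L[ℂ] H) := {p | p ∈ M ∧ p ≠ 0 ∧ star p = p ∧ p * p = p ∧
    FiniteDimensional ℂ (LinearMap.range (p : H →ₗ[ℂ] H))}
  have hS : S.Nonempty := by
    have hr : LinearMap.range (E.starProjection : H →ₗ[ℂ] H) = E :=
      Submodule.range_starProjection E
    refine ⟨E.starProjection, ?_, ?_, isStarProjection_starProjection.isSelfAdjoint,
      isStarProjection_starProjection.isIdempotentElem, ?_⟩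
    · rw [VonNeumannAlgebra.IsStarProjection.mem_iff isStarProjection_starProjection]
      intro y hy
      rw [VonNeumannAlgebra.mem_commutant_iff] at hy
      have h1 := hy T hTM
      erw [hr]
      rw [Module.End.mem_invtSubmodule]
      intro x hx
      rw [Submodule.mem_comap]
      rw [hE, Module.End.mem_eigenspace_iff] at hx ⊢
      have h2 : T (y x) = y (T x) := congrArg (fun f : H →L[ℂ] H => f x) h1
      have hx' : T x = μ • x := hx
      change T (y x) = μ • y x
      rw [h2, hx', map_smul]
    · intro h
      rw [h] at hr
      apply hμ
      simpa using hr.symm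
    · show FiniteDimensional ℂ (LinearMap.range (E.starProjection : H →ₗ[ℂ] H))
      rw [hr]; exact hfin
  let d : (H →L[ℂ] H) → ℕ := fun p => Module.finrank ℂ (LinearMap.range (p : H →ₗ[ℂ] H))
  obtain ⟨p, ⟨hpM, hp0, hps, hpp, hpf⟩, hmin⟩ := exists_minimalFor_of_wellFoundedLT (· ∈ S) d hS
  refine ⟨p, hpM, hp0, hps, hpp, fun q hqM hqs hqq hpq hqp => ?_⟩
  by_cases hq0 : q = 0
  · exact Or.inl hq0
  right
  have hle : LinearMap.range (q : H →ₗ[ℂ] H) ≤ LinearMap.range (p : H →ₗ[ℂ] H) := by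
    rintro _ ⟨x, rfl⟩
    exact ⟨q x, (congrArg (fun f : H →L[ℂ] H => f x) hpq).symm⟩
  have hqf := Submodule.finiteDimensional_of_le hle
  have hdle : d q ≤ d p := Submodule.finrank_mono hle
  have heq := Submodule.eq_of_le_of_finrank_le hle
    (hmin (show q ∈ S from ⟨hqM, hq0, hqs, hqq, hqf⟩) hdle)
  ext x
  have hx : p x ∈ LinearMap.range (q : H →ₗ[ℂ] H) := heq ▸ ⟨x, rfl⟩
  obtain ⟨y, hy⟩ := hx
  have hy' : q y = p x := hy
  have h1 : q x = q (p x) := congrArg (fun f : H →L[ℂ] H => f x) hqp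
  have h2 : q (q y) = q y := congrArg (fun f : H →L[ℂ] H => f y) hqq
  rw [h1, ← hy', h2]
end

section
/- Let H be a complex Hilbert space and let M be a von Neumann algebra acting on H. If M contains a nonzero compact operator, then M contains a nonzero projection of finite rank (i.e. a projection p ∈ M, p ≠ 0, whose range is a finite-dimensional subspace of H). -/
/-- If a von Neumann algebra `M` on a complex Hilbert space contains a nonzero compact
operator, then it contains a nonzero finite-rank projection. -/
theorem stmt_3 {H : Type*} [NormedAddCommGroup H] [InnerProductSpace ℂ H] [CompleteSpace H]
    (M : VonNeumannAlgebra H)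
    (a : H →L[ℂ] H) (haM : a ∈ M) (ha0 : a ≠ 0) (hac : IsCompactOperator a) :
    ∃ p : H →L[ℂ] H, p ∈ M ∧ p ≠ 0 ∧ star p = p ∧ p * p = p ∧
      FiniteDimensional ℂ (LinearMap.range (p : H →ₗ[ℂ] H)) := by
  have hTM : star a * a ∈ M := mul_mem (star_mem haM) haM
  have hT0 : star a * a ≠ 0 := fun h => ha0 (CStarRing.star_mul_self_eq_zero_iff a |>.1 h)
  have hTc : IsCompactOperator (star a * a : H →L[ℂ] H) := hac.clm_comp (star a)
  have hTs : IsSelfAdjoint (star a * a) := IsSelfAdjoint.star_mul_self a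
  generalize star a * a = T at *
  have hsym : (T : H →ₗ[ℂ] H).IsSymmetric := hTs.isSymmetric
  obtain ⟨μ, hμ, hμ0⟩ : ∃ μ : ℂ, Module.End.HasEigenvalue (T : H →ₗ[ℂ] H) μ ∧ μ ≠ 0 := by
    by_contra! h
    exact hT0 ((ContinuousLinearMap.eq_zero_of_forall_hasEigenvalue_eq_zero hTc hsym).1 h)
  have hfd : FiniteDimensional ℂ (Module.End.eigenspace (T : H →ₗ[ℂ] H) μ) :=
    ContinuousLinearMap.finite_dimensional_eigenspace hTc μ hμ0
  set E := Module.End.eigenspace (T : H →ₗ[ℂ] H) μ with hE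
  have hp : IsStarProjection E.starProjection := isStarProjection_starProjection
  have hr : E.starProjection.range = E := Submodule.range_starProjection E
  refine ⟨E.starProjection, ?_, ?_, hp.isSelfAdjoint, hp.isIdempotentElem, ?_⟩
  · rw [VonNeumannAlgebra.IsStarProjection.mem_iff hp, hr]
    intro y hy x hx
    have hc := VonNeumannAlgebra.mem_commutant_iff.1 hy T hTM
    have hx' : T x = μ • x := Module.End.mem_eigenspace_iff.1 hx
    refine Module.End.mem_eigenspace_iff.2 ?_
    have := DFunLike.congr_fun hc x
    simpa [hx'] using this
  · intro h0
    apply hμ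
    rw [h0] at hr
    simpa [hE] using hr.symm
  · rw [hr]; exact hfd
end

section
/- Let H be a complex Hilbert space, M a von Neumann algebra on H, and e ∈ M a projection such that no nonzero minimal projection of M lies below e (that is, there is no projection p ∈ M with p ≠ 0, p = e·p = p·e, and p minimal in M). Then e·a·e = 0 for every compact operator a belonging to M. -/
/-- If `e` is a projection in a von Neumann algebra `M` with no nonzero minimal projection
of `M` below it, then `e * a * e = 0` for every compact operator `a ∈ M`. -/
theorem stmt_4 {H : Type*} [NormedAddCommGroup H] [InnerProductSpace ℂ H] [CompleteSpace H]
    (M : VonNeumannAlgebra H)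
    (e : H →L[ℂ] H) (heM : e ∈ M) (he_star : star e = e) (he_idem : e * e = e)
    (hmin : ¬ ∃ p : H →L[ℂ] H, p ∈ M ∧ p ≠ 0 ∧ star p = p ∧ p * p = p ∧
        p = e * p ∧ p = p * e ∧
        ∀ q : H →L[ℂ] H, q ∈ M → star q = q → q * q = q →
          q = p * q → q = q * p → q = 0 ∨ q = p)
    (a : H →L[ℂ] H) (haM : a ∈ M) (hac : IsCompactOperator a) :
    e * a * e = 0 := by
  -- no nonzero finite rank projection of `M` lies below `e`
  have key : ∀ n : ℕ, ∀ p : H →L[ℂ] H, p ∈ M → p ≠ 0 → star p = p → p * p = p →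
      p = e * p → p = p * e → FiniteDimensional ℂ p.range →
      Module.finrank ℂ p.range = n → False := by
    intro n
    induction n using Nat.strong_induction_on with
    | _ n ih =>
      intro p hpM hp0 hps hpp hep hpe hfin hn
      refine hmin ⟨p, hpM, hp0, hps, hpp, hep, hpe, ?_⟩
      intro q hqM hqs hqq hpq hqp
      by_contra hcon
      push Not at hcon
      obtain ⟨hq0, hqne⟩ := hcon
      have hle : q.range ≤ p.range := by
        rintro x ⟨y, rfl⟩
        exact ⟨q y, (congrArg (fun f : H →L[ℂ] H => f y) hpq).symm⟩
      have hlt : q.range < p.range := by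
        refine lt_of_le_of_ne hle fun h => hqne ?_
        exact ContinuousLinearMap.IsStarProjection.ext ⟨hqq, hqs⟩ ⟨hpp, hps⟩ h
      have hfq : FiniteDimensional ℂ q.range := Submodule.finiteDimensional_of_le hle
      refine ih (Module.finrank ℂ q.range) (hn ▸ Submodule.finrank_lt_finrank_of_lt hlt) q
        hqM hq0 hqs hqq ?_ ?_ hfq rfl
      · calc q = p * q := hpq
          _ = e * p * q := by rw [← hep]
          _ = e * q := by rw [mul_assoc, ← hpq]
      · calc q = q * p := hqp
          _ = q * (p * e) := by rw [← hpe]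
          _ = q * e := by rw [← mul_assoc, ← hqp]
  by_contra hb
  obtain ⟨b, hbdef⟩ : ∃ b, b = e * a * e := ⟨_, rfl⟩
  rw [← hbdef] at hb
  obtain ⟨c, hcdef⟩ : ∃ c, c = star b * b := ⟨_, rfl⟩
  have hbM : b ∈ M := hbdef ▸ mul_mem (mul_mem heM haM) heM
  have hcM : c ∈ M := hcdef ▸ mul_mem (star_mem hbM) hbM
  have hc0 : c ≠ 0 := by
    rw [hcdef]
    exact fun h => hb (CStarRing.star_mul_self_eq_zero_iff b |>.1 h)
  have hcs : star c = c := by rw [hcdef]; simp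
  have hec : e * c = c := by
    rw [hcdef, hbdef]
    simp only [star_mul, he_star, ← mul_assoc, he_idem]
  have hcc : IsCompactOperator c := by
    have h1 : IsCompactOperator b := by
      rw [hbdef]
      exact (hac.clm_comp e).comp_clm e
    rw [hcdef]
    exact h1.clm_comp (star b)
  have hsym : c.IsSymmetric := ContinuousLinearMap.isSelfAdjoint_iff_isSymmetric.1 hcs
  obtain ⟨μ, hμ, hμ0⟩ : ∃ μ, Module.End.HasEigenvalue (c : Module.End ℂ H) μ ∧ μ ≠ 0 := by
    by_contra hcon
    push Not at hcon
    exact hc0 ((ContinuousLinearMap.eq_zero_of_forall_hasEigenvalue_eq_zero hcc hsym).1 hcon)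
  have hfin := ContinuousLinearMap.finite_dimensional_eigenspace hcc μ hμ0
  obtain ⟨V, hV⟩ : ∃ V, V = Module.End.eigenspace c.toLinearMap μ := ⟨_, rfl⟩
  rw [← hV] at hfin
  have hmem : ∀ x, x ∈ V ↔ c x = μ • x := by
    intro x
    rw [hV, Module.End.mem_eigenspace_iff]
    rfl
  have hVe : ∀ x ∈ V, e x = x := by
    intro x hx
    have h1 : e (c x) = c x := congrArg (fun f : H →L[ℂ] H => f x) hec
    rw [(hmem x).1 hx, map_smul] at h1
    exact smul_right_injective H hμ0 h1
  have hP : IsStarProjection V.starProjection := isStarProjection_starProjection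
  have hr : V.starProjection.range = V := Submodule.range_starProjection V
  have hps : star V.starProjection = V.starProjection := hP.isSelfAdjoint.star_eq
  have hep : V.starProjection = e * V.starProjection := by
    ext x
    exact (hVe _ (Submodule.starProjection_apply_mem V x)).symm
  refine key _ V.starProjection ?_ ?_ hps hP.isIdempotentElem hep ?_ (by rw [hr]; exact hfin) rfl
  · rw [VonNeumannAlgebra.IsStarProjection.mem_iff hP]
    intro y hy
    rw [hr, Module.End.mem_invtSubmodule_iff_forall_mem_of_mem]
    intro x hx
    have hcy : c * y = y * c := VonNeumannAlgebra.mem_commutant_iff.1 hy c hcM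
    have h1 : c (y x) = y (c x) := congrArg (fun f : H →L[ℂ] H => f x) hcy
    rw [(hmem x).1 hx, map_smul] at h1
    exact (hmem _).2 h1
  · intro h0
    apply hμ
    change Module.End.eigenspace c.toLinearMap μ = ⊥
    rw [← hV, ← hr, h0]
    simp
  · have := congrArg star hep
    rwa [star_mul, hps, he_star] at this
end
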